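/- arXiv:1202.5223 — 3 statements merged into one kernel-verified Lean document; each statement's English description precedes it below -/
import Mathlib

section
/- The maximal folding function R_K : S^{N-1} → ℝ of a convex body K ⊂ ℝ^N is lower semicontinuous on the unit sphere; in particular, R_K attains its minimum on S^{N-1}. -/
open MeasureTheory Set Metric
open scoped RealInnerProductSpace ENNReal NNReal

noncomputable section

/-- Reflection of `x` across the hyperplane `{z : ⟪z, ω⟫ = l}` (for a unit vector `ω`). -/
def reflectH {N : ℕ} (l : ℝ) (ω x : EuclideanSpace ℝ (Fin N)) : EuclideanSpace ℝ (Fin N) :=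
  x + (2 * (l - ⟪x, ω⟫)) • ω

/-- The maximal folding function of a set `K`:
`R_K(ω) = inf {l : the reflection of K ∩ {⟪·,ω⟫ ≥ l} across {⟪·,ω⟫ = l} lies in K}`. -/
def foldingFn {N : ℕ} (K : Set (EuclideanSpace ℝ (Fin N))) (ω : EuclideanSpace ℝ (Fin N)) : ℝ :=
  sInf {l : ℝ | reflectH l ω '' {x ∈ K | l ≤ ⟪x, ω⟫} ⊆ K}

/-- The heart of a set `K`. -/
def heart {N : ℕ} (K : Set (EuclideanSpace ℝ (Fin N))) : Set (EuclideanSpace ℝ (Fin N)) :=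
  {x ∈ K | ∀ ω : EuclideanSpace ℝ (Fin N), ‖ω‖ = 1 → ⟪x, ω⟫ ≤ foldingFn K ω}

/-- A level `l` is admissible for `K` in direction `ω` iff every point of `K` lies below the
hyperplane or is reflected into `K`; points on the hyperplane are fixed by the reflection. -/
lemma reflectH_image_subset_iff {N : ℕ} (K : Set (EuclideanSpace ℝ (Fin N))) (l : ℝ)
    (ω : EuclideanSpace ℝ (Fin N)) :
    reflectH l ω '' {x ∈ K | l ≤ ⟪x, ω⟫} ⊆ K ↔ ∀ x ∈ K, ⟪x, ω⟫ ≤ l ∨ reflectH l ω x ∈ K := by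
  rw [image_subset_iff]
  constructor
  · intro h x hx
    rcases le_total ⟪x, ω⟫ l with hl | hl
    · exact Or.inl hl
    · exact Or.inr (h ⟨hx, hl⟩)
  · rintro h x ⟨hx, hl⟩
    rcases h x hx with h' | h'
    · have heq : l = ⟪x, ω⟫ := le_antisymm hl h'
      have hfix : reflectH l ω x = x := by simp [reflectH, heq]
      rwa [mem_preimage, hfix]
    · exact h'

lemma isClosed_setOf_reflectH_image_subset {N : ℕ} {K : Set (EuclideanSpace ℝ (Fin N))}
    (hK : IsClosed K) :
    IsClosed {p : ℝ × EuclideanSpace ℝ (Fin N) |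
      reflectH p.1 p.2 '' {x ∈ K | p.1 ≤ ⟪x, p.2⟫} ⊆ K} := by
  simp only [reflectH_image_subset_iff, Set.ofPred_forall, Set.ofPred_or]
  refine isClosed_biInter fun x _ => IsClosed.union ?_ ?_
  · exact isClosed_le (by fun_prop) (by fun_prop)
  · refine hK.preimage (f := fun p : ℝ × EuclideanSpace ℝ (Fin N) => reflectH p.1 p.2 x) ?_
    unfold reflectH
    fun_prop

lemma inner_reflectH {N : ℕ} (l : ℝ) {ω : EuclideanSpace ℝ (Fin N)} (hω : ‖ω‖ = 1)
    (x : EuclideanSpace ℝ (Fin N)) : ⟪reflectH l ω x, ω⟫ = 2 * l - ⟪x, ω⟫ := by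
  rw [reflectH, inner_add_left, real_inner_smul_left, real_inner_self_eq_norm_sq, hω]
  ring

lemma abs_inner_le_of_norm_le {N : ℕ} {ω x : EuclideanSpace ℝ (Fin N)} {M : ℝ}
    (hω : ‖ω‖ = 1) (hx : ‖x‖ ≤ M) : |⟪x, ω⟫| ≤ M := by
  have h := abs_real_inner_le_norm x ω
  rw [hω, mul_one] at h
  exact h.trans hx

lemma neg_le_of_reflectH_image_subset {N : ℕ} {K : Set (EuclideanSpace ℝ (Fin N))}
    (hne : K.Nonempty) {M : ℝ} (hM : ∀ x ∈ K, ‖x‖ ≤ M) {ω : EuclideanSpace ℝ (Fin N)}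
    (hω : ‖ω‖ = 1) {l : ℝ} (hl : reflectH l ω '' {x ∈ K | l ≤ ⟪x, ω⟫} ⊆ K) : -M ≤ l := by
  obtain ⟨x, hx⟩ := hne
  have hx' := (abs_le.1 (abs_inner_le_of_norm_le hω (hM x hx))).1
  rcases (reflectH_image_subset_iff K l ω).1 hl x hx with h | h
  · exact hx'.trans h
  · have := (abs_le.1 (abs_inner_le_of_norm_le hω (hM _ h))).1
    rw [inner_reflectH l hω] at this
    linarith

/-- The infimum defining `foldingFn` is attained. -/
lemma reflectH_foldingFn_image_subset {N : ℕ} {K : Set (EuclideanSpace ℝ (Fin N))}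
    (hK : IsClosed K) (hne : K.Nonempty) {M : ℝ} (hM : ∀ x ∈ K, ‖x‖ ≤ M)
    {ω : EuclideanSpace ℝ (Fin N)} (hω : ‖ω‖ = 1) :
    reflectH (foldingFn K ω) ω '' {x ∈ K | foldingFn K ω ≤ ⟪x, ω⟫} ⊆ K := by
  have hcl : IsClosed {l : ℝ | reflectH l ω '' {x ∈ K | l ≤ ⟪x, ω⟫} ⊆ K} :=
    (isClosed_setOf_reflectH_image_subset hK).preimage
      (f := fun l : ℝ => (l, ω)) (by fun_prop)
  refine hcl.csInf_mem ⟨M, ?_⟩ ⟨-M, fun l hl => neg_le_of_reflectH_image_subset hne hM hω hl⟩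
  exact (reflectH_image_subset_iff K M ω).2 fun x hx =>
    Or.inl (abs_le.1 (abs_inner_le_of_norm_le hω (hM x hx))).2

/-- The folding function of any nonempty compact set is lower semicontinuous on the sphere. -/
lemma lowerSemicontinuousOn_foldingFn {N : ℕ} {K : Set (EuclideanSpace ℝ (Fin N))}
    (hK : IsCompact K) (hne : K.Nonempty) :
    LowerSemicontinuousOn (foldingFn K) (sphere (0 : EuclideanSpace ℝ (Fin N)) 1) := by
  obtain ⟨M, hM⟩ := hK.isBounded.exists_norm_le
  intro ω hω y hy
  have hG : IsCompact ((Icc (-M) y ×ˢ sphere (0 : EuclideanSpace ℝ (Fin N)) 1) ∩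
      {p : ℝ × EuclideanSpace ℝ (Fin N) |
        reflectH p.1 p.2 '' {x ∈ K | p.1 ≤ ⟪x, p.2⟫} ⊆ K}) :=
    (isCompact_Icc.prod (isCompact_sphere _ _)).inter_right
      (isClosed_setOf_reflectH_image_subset hK.isClosed)
  have hS := (hG.image continuous_snd).isClosed
  have hωS : ω ∉ Prod.snd '' ((Icc (-M) y ×ˢ sphere (0 : EuclideanSpace ℝ (Fin N)) 1) ∩
      {p : ℝ × EuclideanSpace ℝ (Fin N) |
        reflectH p.1 p.2 '' {x ∈ K | p.1 ≤ ⟪x, p.2⟫} ⊆ K}) := by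
    rintro ⟨⟨l, ω'⟩, ⟨⟨hl, -⟩, hF⟩, rfl⟩
    refine hy.not_ge (le_trans (csInf_le ⟨-M, fun l' hl' => ?_⟩ hF) hl.2)
    exact neg_le_of_reflectH_image_subset hne hM (mem_sphere_zero_iff_norm.1 hω) hl'
  filter_upwards [self_mem_nhdsWithin, mem_nhdsWithin_of_mem_nhds (hS.isOpen_compl.mem_nhds hωS)]
    with ω' hω' hS'
  by_contra! hle
  have hF := reflectH_foldingFn_image_subset hK.isClosed hne hM (mem_sphere_zero_iff_norm.1 hω')
  exact hS' ⟨(foldingFn K ω', ω'), ⟨⟨⟨neg_le_of_reflectH_image_subset hne hM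
    (mem_sphere_zero_iff_norm.1 hω') hF, hle⟩, hω'⟩, hF⟩, rfl⟩

/-- The maximal folding function of a convex body is lower semicontinuous on the unit
sphere; in particular it attains its minimum there. -/
theorem statement0 {N : ℕ} (hN : 0 < N) (K : Set (EuclideanSpace ℝ (Fin N)))
    (hKcpt : IsCompact K) (hKconv : Convex ℝ K) (hKint : (interior K).Nonempty) :
    LowerSemicontinuousOn (foldingFn K) (sphere (0 : EuclideanSpace ℝ (Fin N)) 1) ∧
    ∃ θ ∈ sphere (0 : EuclideanSpace ℝ (Fin N)) 1,
      ∀ ω ∈ sphere (0 : EuclideanSpace ℝ (Fin N)) 1, foldingFn K θ ≤ foldingFn K ω := by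
  have hlsc := lowerSemicontinuousOn_foldingFn hKcpt (hKint.mono interior_subset)
  have : Nonempty (Fin N) := ⟨⟨0, hN⟩⟩
  obtain ⟨θ, hθ, hmin⟩ := hlsc.exists_isMinOn
    (NormedSpace.sphere_nonempty.2 zero_le_one) (isCompact_sphere _ _)
  exact ⟨hlsc, θ, hθ, fun ω hω => hmin hω⟩
end
end

section
/- Let K ⊂ ℝ^N be a convex body and suppose there exist k (1 ≤ k ≤ N) linearly independent directions ω_1, …, ω_k ∈ S^{N-1} such that K is ω_j-symmetric (i.e. T_{λ,ω_j}(K) = K for some λ) for each j = 1, …, k. Then R_K(ω_j) = ⟨M_K, ω_j⟩ for j = 1, …, k, and ♥(K) is contained in the intersection of the k hyperplanes π_{R_K(ω_j), ω_j}; in particular, the heart ♥(K) is contained in an affine subspace of dimension at most N − k. -/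
open MeasureTheory Set Metric
open scoped RealInnerProductSpace ENNReal NNReal

noncomputable section

/-- The center of mass of `K` (w.r.t. Lebesgue measure). -/
def centerOfMass {N : ℕ} (K : Set (EuclideanSpace ℝ (Fin N))) : EuclideanSpace ℝ (Fin N) :=
  (volume K).toReal⁻¹ • ∫ y in K, y

lemma reflectH_neg {N : ℕ} (l : ℝ) (ω : EuclideanSpace ℝ (Fin N)) :
    reflectH (-l) (-ω) = reflectH l ω := by
  ext1 x
  rw [reflectH, reflectH, inner_neg_right, smul_neg, ← neg_smul]
  congr 2
  ring

lemma reflectH_eq_reflection_add {N : ℕ} (l : ℝ) {ω : EuclideanSpace ℝ (Fin N)} (hω : ‖ω‖ = 1)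
    (x : EuclideanSpace ℝ (Fin N)) :
    reflectH l ω x = (ℝ ∙ ω)ᗮ.reflection x + (2 * l) • ω := by
  rw [Submodule.reflection_orthogonal_apply, Submodule.reflection_singleton_apply, hω, reflectH,
    real_inner_comm]
  simp only [RCLike.ofReal_real_eq_id, id, one_pow, div_one]
  module

lemma measurePreserving_reflectH {N : ℕ} (l : ℝ) {ω : EuclideanSpace ℝ (Fin N)} (hω : ‖ω‖ = 1) :
    MeasurePreserving (reflectH l ω) volume volume := by
  rw [funext (reflectH_eq_reflection_add l hω)]
  exact (measurePreserving_add_right volume ((2 * l) • ω)).comp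
    (ℝ ∙ ω)ᗮ.reflection.measurePreserving

lemma injective_reflectH {N : ℕ} (l : ℝ) {ω : EuclideanSpace ℝ (Fin N)} (hω : ‖ω‖ = 1) :
    Function.Injective (reflectH l ω) := by
  rw [funext (reflectH_eq_reflection_add l hω)]
  exact (add_left_injective _).comp (LinearIsometryEquiv.injective _)

lemma measurableEmbedding_reflectH {N : ℕ} (l : ℝ) {ω : EuclideanSpace ℝ (Fin N)}
    (hω : ‖ω‖ = 1) : MeasurableEmbedding (reflectH l ω) :=
  (measurePreserving_reflectH l hω).measurable.measurableEmbedding (injective_reflectH l hω)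

/-- In a direction of symmetry, the folding function is the level of the symmetry hyperplane. -/
lemma foldingFn_eq_of_symm {N : ℕ} {K : Set (EuclideanSpace ℝ (Fin N))}
    (hK : IsCompact K) (hne : K.Nonempty) {ω : EuclideanSpace ℝ (Fin N)} (hω : ‖ω‖ = 1)
    {l : ℝ} (hsym : reflectH l ω '' K = K) : foldingFn K ω = l := by
  have hmaps : ∀ x ∈ K, reflectH l ω x ∈ K := fun x hx => hsym ▸ mem_image_of_mem _ hx
  have hleast : IsLeast {m : ℝ | reflectH m ω '' {x ∈ K | m ≤ ⟪x, ω⟫} ⊆ K} l := by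
    refine ⟨image_subset_iff.2 fun x hx => hmaps x hx.1, fun m hm => ?_⟩
    obtain ⟨x, hxK, hx⟩ := hK.exists_isMaxOn hne
      (f := fun x => ⟪x, ω⟫) (by fun_prop)
    by_contra! hml
    have hxl : ⟪reflectH l ω x, ω⟫ ≤ ⟪x, ω⟫ := hx (hmaps x hxK)
    rw [inner_reflectH l hω] at hxl
    have hfold : reflectH m ω x ∈ K := hm ⟨x, ⟨hxK, by linarith⟩, rfl⟩
    have hlt : ⟪reflectH l ω (reflectH m ω x), ω⟫ ≤ ⟪x, ω⟫ := hx (hmaps _ hfold)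
    rw [inner_reflectH l hω, inner_reflectH m hω] at hlt
    linarith
  exact hleast.csInf_eq

/-- The center of mass lies on every hyperplane of symmetry. -/
lemma inner_centerOfMass_of_symm {N : ℕ} {K : Set (EuclideanSpace ℝ (Fin N))}
    (hK : IsCompact K) (hint : (interior K).Nonempty) {ω : EuclideanSpace ℝ (Fin N)}
    (hω : ‖ω‖ = 1) {l : ℝ} (hsym : reflectH l ω '' K = K) : ⟪centerOfMass K, ω⟫ = l := by
  have hpos : 0 < (volume K).toReal :=
    ENNReal.toReal_pos (Measure.measure_pos_of_nonempty_interior _ hint).ne' hK.measure_lt_top.ne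
  have hid : IntegrableOn (fun y : EuclideanSpace ℝ (Fin N) => y) K :=
    continuous_id.continuousOn.integrableOn_compact hK
  have hinner : IntegrableOn (fun y : EuclideanSpace ℝ (Fin N) => ⟪y, ω⟫) K :=
    ContinuousOn.integrableOn_compact hK (by fun_prop)
  have hflip : ∫ y in K, ⟪y, ω⟫ = ∫ y in K, (2 * l - ⟪y, ω⟫) := by
    conv_lhs => rw [← hsym]
    rw [(measurePreserving_reflectH l hω).setIntegral_image_emb
      (measurableEmbedding_reflectH l hω)]
    simp only [inner_reflectH l hω]
  have : IsFiniteMeasure (volume.restrict K) := ⟨by simpa using hK.measure_lt_top⟩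
  rw [integral_sub (integrable_const _) hinner, setIntegral_const, smul_eq_mul,
    measureReal_def] at hflip
  have hcomm : ⟪∫ y in K, y, ω⟫ = ∫ y in K, ⟪y, ω⟫ := by
    simpa only [real_inner_comm ω] using (integral_inner hid ω).symm
  rw [centerOfMass, real_inner_smul_left, hcomm, inv_mul_eq_iff_eq_mul₀ hpos.ne']
  linarith

/-- If `K` is symmetric in `k` linearly independent directions, then the folding function
agrees with `⟪M_K, ·⟫` on those directions, the heart lies in the intersection of the
corresponding hyperplanes, and hence in an affine subspace of dimension at most `N - k`. -/
theorem statement3 {N : ℕ} (K : Set (EuclideanSpace ℝ (Fin N)))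
    (hKcpt : IsCompact K) (hKconv : Convex ℝ K) (hKint : (interior K).Nonempty)
    (k : ℕ) (hk₁ : 1 ≤ k) (hk₂ : k ≤ N)
    (ω : Fin k → EuclideanSpace ℝ (Fin N)) (hind : LinearIndependent ℝ ω)
    (hunit : ∀ j, ‖ω j‖ = 1)
    (hsym : ∀ j, ∃ l : ℝ, reflectH l (ω j) '' K = K) :
    (∀ j, foldingFn K (ω j) = ⟪centerOfMass K, ω j⟫) ∧
    (heart K ⊆ ⋂ j, {x : EuclideanSpace ℝ (Fin N) | ⟪x, ω j⟫ = foldingFn K (ω j)}) ∧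
    ∃ S : AffineSubspace ℝ (EuclideanSpace ℝ (Fin N)),
      heart K ⊆ (S : Set (EuclideanSpace ℝ (Fin N))) ∧
      Module.finrank ℝ S.direction ≤ N - k := by
  have hne : K.Nonempty := hKint.mono interior_subset
  choose l hl using hsym
  have hR : ∀ j, foldingFn K (ω j) = l j := fun j =>
    foldingFn_eq_of_symm hKcpt hne (hunit j) (hl j)
  have hM : ∀ j, ⟪centerOfMass K, ω j⟫ = l j := fun j =>
    inner_centerOfMass_of_symm hKcpt hKint (hunit j) (hl j)
  have hheart : ∀ x ∈ heart K, ∀ j, ⟪x, ω j⟫ = l j := by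
    intro x hx j
    have hunit' : ‖-ω j‖ = 1 := by rw [norm_neg, hunit j]
    have hle := hx.2 (ω j) (hunit j)
    have hge := hx.2 (-ω j) hunit'
    rw [hR] at hle
    rw [foldingFn_eq_of_symm (l := -l j) hKcpt hne hunit' (by rw [reflectH_neg, hl]),
      inner_neg_right] at hge
    linarith
  refine ⟨fun j => by rw [hR, hM], fun x hx => mem_iInter.2 fun j => ?_,
    AffineSubspace.mk' (centerOfMass K) (Submodule.span ℝ (range ω))ᗮ, fun x hx => ?_, ?_⟩
  · rw [mem_ofPred_eq, hR, hheart x hx]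
  · rw [SetLike.mem_coe, AffineSubspace.mem_mk', vsub_eq_sub, Submodule.mem_orthogonal']
    intro u hu
    induction hu using Submodule.span_induction with
    | mem u hu =>
      obtain ⟨j, rfl⟩ := hu
      rw [inner_sub_left, hheart x hx, hM, sub_self]
    | zero => exact inner_zero_right _
    | add u v _ _ hu hv => rw [inner_add_right, hu, hv, add_zero]
    | smul a u _ hu => rw [real_inner_smul_right, hu, mul_zero]
  · have hspan := finrank_span_eq_card hind
    have hsum := (Submodule.span ℝ (range ω)).finrank_add_finrank_orthogonal
    rw [hspan, finrank_euclideanSpace_fin, Fintype.card_fin] at hsum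
    rw [AffineSubspace.direction_mk']
    omega
end
end

section
/- For every convex body K ⊂ ℝ^N, the circumcenter C_K of K — the center of the unique smallest closed ball containing K — belongs to the heart ♥(K). -/
open MeasureTheory Set Metric
open scoped RealInnerProductSpace ENNReal NNReal

noncomputable section

/-- The squared distance from `x` to a reflected point. -/
lemma norm_sub_reflectH_sq {N : ℕ} (l : ℝ) {ω : EuclideanSpace ℝ (Fin N)} (hω : ‖ω‖ = 1)
    (x y : EuclideanSpace ℝ (Fin N)) :
    ‖x - reflectH l ω y‖ ^ 2 = ‖x - y‖ ^ 2 + 4 * (l - ⟪y, ω⟫) * (l - ⟪x, ω⟫) := by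
  have h : x - reflectH l ω y = (x - y) - (2 * (l - ⟪y, ω⟫)) • ω := by
    unfold reflectH; abel
  rw [h, norm_sub_sq_real, norm_smul, inner_smul_right, inner_sub_left, hω, mul_one,
    Real.norm_eq_abs, sq_abs]
  ring

lemma dist_reflectH_comm {N : ℕ} (l : ℝ) {ω : EuclideanSpace ℝ (Fin N)} (hω : ‖ω‖ = 1)
    (x y : EuclideanSpace ℝ (Fin N)) :
    dist x (reflectH l ω y) = dist (reflectH l ω x) y := by
  rw [dist_comm _ y, dist_eq_norm, dist_eq_norm,
    ← sq_eq_sq₀ (norm_nonneg _) (norm_nonneg _), norm_sub_reflectH_sq l hω,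
    norm_sub_reflectH_sq l hω, norm_sub_rev x y]
  ring

/-- A nonempty compact convex set contained in a ball is contained in a ball of the same radius
centered at one of its points. -/
lemma exists_mem_subset_closedBall {N : ℕ} {K : Set (EuclideanSpace ℝ (Fin N))}
    (hK : IsCompact K) (hconv : Convex ℝ K) (hne : K.Nonempty)
    {C : EuclideanSpace ℝ (Fin N)} {R : ℝ} (hball : K ⊆ closedBall C R) :
    ∃ p ∈ K, K ⊆ closedBall p R := by
  obtain ⟨p, hp, hmin⟩ := exists_norm_eq_iInf_of_complete_convex hne hK.isComplete hconv C
  have hobtuse := (norm_eq_iInf_iff_real_inner_le_zero hconv hp).1 hmin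
  refine ⟨p, hp, fun x hx => ?_⟩
  have hxC : ‖x - C‖ ≤ R := by simpa [dist_eq_norm] using hball hx
  have hsq : ‖x - C‖ ^ 2 = ‖x - p‖ ^ 2 - 2 * ⟪C - p, x - p⟫ + ‖C - p‖ ^ 2 := by
    rw [← sub_sub_sub_cancel_right x C p, norm_sub_sq_real, real_inner_comm]
  have hle : ‖x - p‖ ≤ ‖x - C‖ := by
    rw [← sq_le_sq₀ (norm_nonneg _) (norm_nonneg _)]
    nlinarith [hobtuse x hx, sq_nonneg ‖C - p‖]
  simpa [dist_eq_norm] using hle.trans hxC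

/-- A compact set admits a folding hyperplane in every direction. -/
lemma nonempty_setOf_reflectH_image_subset {N : ℕ} {K : Set (EuclideanSpace ℝ (Fin N))}
    (hK : IsCompact K) (ω : EuclideanSpace ℝ (Fin N)) :
    {l : ℝ | reflectH l ω '' {x ∈ K | l ≤ ⟪x, ω⟫} ⊆ K}.Nonempty := by
  obtain ⟨M, hM⟩ := (hK.image (f := fun x => ⟪x, ω⟫) (by fun_prop)).bddAbove
  refine ⟨M, ?_⟩
  rintro _ ⟨x, ⟨hx, hMx⟩, rfl⟩
  have hxM : ⟪x, ω⟫ = M := le_antisymm (hM (mem_image_of_mem _ hx)) hMx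
  simpa [reflectH, hxM] using hx

/-- Folding across a hyperplane lying below `C` keeps the set in the ball around the reflection
of `C`. -/
lemma subset_closedBall_reflectH {N : ℕ} {K : Set (EuclideanSpace ℝ (Fin N))}
    {C ω : EuclideanSpace ℝ (Fin N)} {R l : ℝ} (hω : ‖ω‖ = 1) (hball : K ⊆ closedBall C R)
    (hfold : reflectH l ω '' {x ∈ K | l ≤ ⟪x, ω⟫} ⊆ K) (hl : l ≤ ⟪C, ω⟫) :
    K ⊆ closedBall (reflectH l ω C) R := by
  intro x hx
  rw [mem_closedBall]
  rcases le_total l ⟪x, ω⟫ with h | h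
  · rw [dist_reflectH_comm l hω]
    exact hball (hfold ⟨x, ⟨hx, h⟩, rfl⟩)
  · refine le_trans ?_ (hball hx)
    rw [dist_eq_norm, dist_eq_norm, ← sq_le_sq₀ (norm_nonneg _) (norm_nonneg _),
      norm_sub_reflectH_sq l hω]
    nlinarith [mul_nonneg (sub_nonneg.2 hl) (sub_nonneg.2 h)]

/-- The circumcenter of a convex body (the center of the unique smallest closed ball
containing it) belongs to the heart. -/
theorem statement5 {N : ℕ} (K : Set (EuclideanSpace ℝ (Fin N)))
    (hKcpt : IsCompact K) (hKconv : Convex ℝ K) (hKint : (interior K).Nonempty)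
    (C : EuclideanSpace ℝ (Fin N)) (R : ℝ)
    (hball : K ⊆ closedBall C R)
    (hmin : ∀ (C' : EuclideanSpace ℝ (Fin N)) (R' : ℝ), K ⊆ closedBall C' R' → R ≤ R')
    (huniq : ∀ C' : EuclideanSpace ℝ (Fin N), K ⊆ closedBall C' R → C' = C) :
    C ∈ heart K := by
  refine ⟨?_, fun ω hω => le_csInf (nonempty_setOf_reflectH_image_subset hKcpt ω) ?_⟩
  · obtain ⟨p, hp, hpK⟩ :=
      exists_mem_subset_closedBall hKcpt hKconv (hKint.mono interior_subset) hball
    exact huniq p hpK ▸ hp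
  · intro l hfold
    by_contra! hl
    have hfix := huniq _ (subset_closedBall_reflectH hω hball hfold hl.le)
    have hsq := norm_sub_reflectH_sq l hω C C
    rw [hfix, sub_self, norm_zero] at hsq
    nlinarith [mul_pos (sub_pos.2 hl) (sub_pos.2 hl)]
end
end
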